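/- arXiv:2103.16509 — 6 statements merged into one kernel-verified Lean document; each statement's English description precedes it below -/
import Mathlib

section
/- Let γ > 0 and suppose the data matrices generated by an experiment on the nonlinear system satisfy: (i) the stacked (m+n)×T matrix [U₀; X₀] has full row rank m+n and X₁ has full row rank n, and (ii) D₀D₀ᵀ ⪯ γ X₁X₁ᵀ in the Loewner order. If a pair (Q, α) with Q ∈ ℝ^{T×n} and α > 0 is feasible for the data LMIs and moreover γ < α²/(4 + 2α), then the matrix X₀Q is invertible and the state-feedback gain K := U₀Q(X₀Q)⁻¹ locally exponentially stabilizes the origin of the closed-loop system x(k+1) = f(x(k), Kx(k)). -/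
open Matrix

/-- A positive definite quadratic form dominates a multiple of the squared sup norm. -/
theorem aux_lower {n : ℕ} (q : (Fin n → ℝ) → ℝ) (hc : Continuous q)
    (hh : ∀ (t : ℝ) x, q (t • x) = t ^ 2 * q x)
    (hp : ∀ x, x ≠ 0 → 0 < q x) : ∃ c > (0 : ℝ), ∀ x, c * ‖x‖ ^ 2 ≤ q x := by
  have h0 : q 0 = 0 := by simpa using hh 0 0
  by_cases hne : (Metric.sphere (0 : Fin n → ℝ) 1).Nonempty
  · obtain ⟨y, hy, hmin⟩ := (isCompact_sphere (0 : Fin n → ℝ) 1).exists_isMinOn hne hc.continuousOn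
    have hy1 : ‖y‖ = 1 := by simpa using hy
    have hy0 : y ≠ 0 := by
      rintro rfl
      simp at hy1
    refine ⟨q y, hp y hy0, fun x => ?_⟩
    by_cases hx : x = 0
    · simp [hx, h0]
    have hxn : 0 < ‖x‖ := norm_pos_iff.mpr hx
    have hmem : ‖x‖⁻¹ • x ∈ Metric.sphere (0 : Fin n → ℝ) 1 := by
      simp [norm_smul, hxn.ne']
    have h1 : q y ≤ q (‖x‖⁻¹ • x) := hmin hmem
    have h2 : q x = ‖x‖ ^ 2 * q (‖x‖⁻¹ • x) := by
      rw [← hh, smul_smul, mul_inv_cancel₀ hxn.ne', one_smul]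
    rw [h2]
    nlinarith [sq_nonneg ‖x‖]
  · refine ⟨1, one_pos, fun x => ?_⟩
    by_cases hx : x = 0
    · simp [hx, h0]
    · exfalso
      have hxn : 0 < ‖x‖ := norm_pos_iff.mpr hx
      exact hne ⟨‖x‖⁻¹ • x, by simp [norm_smul, hxn.ne']⟩

theorem aux_upper {n : ℕ} (S : Matrix (Fin n) (Fin n) ℝ) :
    ∃ C > (0 : ℝ), ∀ w y : Fin n → ℝ, |w ⬝ᵥ S *ᵥ y| ≤ C * ‖w‖ * ‖y‖ := by
  refine ⟨(∑ i, ∑ j, |S i j|) + 1, by positivity, fun w y => ?_⟩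
  have h : |w ⬝ᵥ S *ᵥ y| ≤ (∑ i, ∑ j, |S i j|) * ‖w‖ * ‖y‖ := by
    simp only [dotProduct, mulVec, Finset.mul_sum, Finset.sum_mul]
    refine (Finset.abs_sum_le_sum_abs _ _).trans (Finset.sum_le_sum fun i _ => ?_)
    refine (Finset.abs_sum_le_sum_abs _ _).trans (Finset.sum_le_sum fun j _ => ?_)
    rw [abs_mul, abs_mul]
    have h1 : |w i| ≤ ‖w‖ := norm_le_pi_norm w i
    have h2 : |y j| ≤ ‖y‖ := norm_le_pi_norm y j
    calc |w i| * (|S i j| * |y j|) ≤ ‖w‖ * (|S i j| * ‖y‖) := by gcongr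
      _ = _ := by ring
  have : 0 ≤ ‖w‖ * ‖y‖ := by positivity
  nlinarith

theorem aux_stab {n : ℕ} (g : (Fin n → ℝ) → (Fin n → ℝ)) (M S : Matrix (Fin n) (Fin n) ℝ)
    (hg0 : g 0 = 0)
    (hg : ∀ ε > (0 : ℝ), ∃ δ > (0 : ℝ), ∀ z, ‖z‖ ≤ δ → ‖g z - M *ᵥ z‖ ≤ ε * ‖z‖)
    (hS : ∀ x, x ≠ 0 → 0 < x ⬝ᵥ S *ᵥ x)
    (hM : ∀ x, x ≠ 0 → (M *ᵥ x) ⬝ᵥ S *ᵥ (M *ᵥ x) < x ⬝ᵥ S *ᵥ x) :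
    ∃ δ > (0 : ℝ), ∃ c > (0 : ℝ), ∃ ρ ∈ Set.Ioo (0 : ℝ) 1,
          ∀ z : ℕ → Fin n → ℝ, (∀ k, z (k + 1) = g (z k)) →
            ‖z 0‖ ≤ δ → ∀ k, ‖z k‖ ≤ c * ρ ^ k * ‖z 0‖ := by
  obtain ⟨c1, hc1, hl⟩ := aux_lower (fun x => x ⬝ᵥ S *ᵥ x) (by fun_prop)
    (fun t x => by simp [mulVec_smul]; ring) hS
  obtain ⟨c0, hc0, hd⟩ := aux_lower
    (fun x => x ⬝ᵥ S *ᵥ x - (M *ᵥ x) ⬝ᵥ S *ᵥ (M *ᵥ x)) (by fun_prop)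
    (fun t x => by simp [mulVec_smul]; ring) (fun x hx => sub_pos.mpr (hM x hx))
  obtain ⟨C, hC, hu⟩ := aux_upper S
  obtain ⟨C2, hC2, hu2⟩ := aux_upper (S * M)
  obtain ⟨C3, hC3, hu3⟩ := aux_upper (Mᵀ * S)
  set ε : ℝ := min 1 (c0 / (2 * (C + C2 + C3))) with hε
  have hεp : 0 < ε := by positivity
  have hε1 : ε ≤ 1 := min_le_left _ _
  have hε2 : ε * (C + C2 + C3) ≤ c0 / 2 := by
    have : ε ≤ c0 / (2 * (C + C2 + C3)) := min_le_right _ _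
    rw [le_div_iff₀ (by positivity)] at this
    linarith
  obtain ⟨δ, hδ, hgδ⟩ := hg ε hεp
  set D : ℝ := C + c0 + c1 with hD
  have hDp : 0 < D := by positivity
  have hVu : ∀ y, y ⬝ᵥ S *ᵥ y ≤ D * ‖y‖ ^ 2 := fun y => by
    have := (le_abs_self _).trans (hu y y)
    have h2 : 0 ≤ (c0 + c1) * ‖y‖ ^ 2 := by positivity
    nlinarith
  set r : ℝ := 1 - c0 / (2 * D) with hr
  have hrr : c0 / (2 * D) < 1 := by
    rw [div_lt_one (by positivity)]; linarith
  have hr1 : r < 1 := by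
    have : 0 < c0 / (2 * D) := by positivity
    linarith
  have hr0 : 0 < r := by linarith
  have hstep : ∀ y, ‖y‖ ≤ δ → (g y) ⬝ᵥ S *ᵥ (g y) ≤ r * (y ⬝ᵥ S *ᵥ y) := by
    intro y hy
    obtain ⟨e, he⟩ : ∃ e, e = g y - M *ᵥ y := ⟨_, rfl⟩
    have hge : g y = M *ᵥ y + e := by rw [he]; abel
    have hen : ‖e‖ ≤ ε * ‖y‖ := he ▸ hgδ y hy
    have e1 : g y ⬝ᵥ S *ᵥ g y = (M *ᵥ y) ⬝ᵥ S *ᵥ (M *ᵥ y) + e ⬝ᵥ (S * M) *ᵥ y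
        + y ⬝ᵥ (Mᵀ * S) *ᵥ e + e ⬝ᵥ S *ᵥ e := by
      rw [hge, ← mulVec_mulVec, ← mulVec_mulVec, dotProduct_mulVec y Mᵀ, vecMul_transpose]
      simp only [mulVec_add, dotProduct_add, add_dotProduct]
      ring
    have n0 := norm_nonneg y
    have n1 := norm_nonneg e
    have b1 : e ⬝ᵥ (S * M) *ᵥ y ≤ C2 * ε * ‖y‖ ^ 2 := by
      refine (le_abs_self _).trans ((hu2 e y).trans ?_)
      calc C2 * ‖e‖ * ‖y‖ ≤ C2 * (ε * ‖y‖) * ‖y‖ := by gcongr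
        _ = _ := by ring
    have b2 : y ⬝ᵥ (Mᵀ * S) *ᵥ e ≤ C3 * ε * ‖y‖ ^ 2 := by
      refine (le_abs_self _).trans ((hu3 y e).trans ?_)
      calc C3 * ‖y‖ * ‖e‖ ≤ C3 * ‖y‖ * (ε * ‖y‖) := by gcongr
        _ = _ := by ring
    have b3 : e ⬝ᵥ S *ᵥ e ≤ C * ε * ‖y‖ ^ 2 := by
      refine (le_abs_self _).trans ((hu e e).trans ?_)
      calc C * ‖e‖ * ‖e‖ ≤ C * (ε * ‖y‖) * (1 * ‖y‖) := by
            gcongr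
            exact hen.trans (by gcongr)
        _ = _ := by ring
    have h1 := hd y
    have h2 := hVu y
    have h3 : ε * (C + C2 + C3) * ‖y‖ ^ 2 ≤ c0 / 2 * ‖y‖ ^ 2 := by gcongr
    have h4 : c0 / (2 * D) * (y ⬝ᵥ S *ᵥ y) ≤ c0 / (2 * D) * (D * ‖y‖ ^ 2) := by gcongr
    have h5 : c0 / (2 * D) * (D * ‖y‖ ^ 2) = c0 / 2 * ‖y‖ ^ 2 := by field_simp
    rw [e1, hr]
    linarith
  have hDc : 0 < D / c1 := by positivity
  have hsD : 0 < √(D / c1) := Real.sqrt_pos.mpr hDc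
  refine ⟨δ / √(D / c1), by positivity, √(D / c1), hsD, √r,
    ⟨Real.sqrt_pos.mpr hr0, by rw [Real.sqrt_lt' one_pos]; simpa using hr1⟩, ?_⟩
  intro z hz hz0
  have key : ∀ k, z k ⬝ᵥ S *ᵥ z k ≤ r ^ k * (z 0 ⬝ᵥ S *ᵥ z 0) →
      ‖z k‖ ≤ √(D / c1) * √r ^ k * ‖z 0‖ := by
    intro k hk
    refine le_of_sq_le_sq ?_ (by positivity)
    have : (√(D / c1) * √r ^ k * ‖z 0‖) ^ 2 = D / c1 * r ^ k * ‖z 0‖ ^ 2 := by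
      rw [mul_pow, mul_pow, Real.sq_sqrt hDc.le, ← pow_mul, mul_comm k 2, pow_mul,
        Real.sq_sqrt hr0.le]
    rw [this]
    have h1 := hl (z k)
    have h2 : r ^ k * (z 0 ⬝ᵥ S *ᵥ z 0) ≤ r ^ k * (D * ‖z 0‖ ^ 2) := by
      gcongr
      exact hVu _
    have h3 : D / c1 * r ^ k * ‖z 0‖ ^ 2 = (r ^ k * (D * ‖z 0‖ ^ 2)) / c1 := by ring
    rw [h3, le_div_iff₀ hc1]
    linarith
  have hV : ∀ k, z k ⬝ᵥ S *ᵥ z k ≤ r ^ k * (z 0 ⬝ᵥ S *ᵥ z 0) := by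
    intro k
    induction k with
    | zero => simp
    | succ k ih =>
      have hb := key k ih
      have hle : ‖z k‖ ≤ δ := by
        refine hb.trans ?_
        rw [le_div_iff₀ hsD] at hz0
        have : √r ^ k ≤ 1 := pow_le_one₀ (Real.sqrt_nonneg _) (by
          rw [Real.sqrt_le_left zero_le_one]; simpa using hr1.le)
        calc √(D / c1) * √r ^ k * ‖z 0‖ ≤ √(D / c1) * 1 * ‖z 0‖ := by gcongr
          _ ≤ δ := by linarith
      rw [hz k, pow_succ]
      have := hstep _ hle
      nlinarith [mul_le_mul_of_nonneg_left ih hr0.le]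
  exact fun k => key k (hV k)

theorem aux_inj {n T : ℕ} (X : Matrix (Fin n) (Fin T) ℝ) (h : X.rank = n) (v : Fin n → ℝ)
    (hv : Xᵀ *ᵥ v = 0) : v = 0 := by
  have h1 : Xᵀ.rank = n := by rw [rank_transpose, h]
  have h2 := LinearMap.finrank_range_add_finrank_ker Xᵀ.mulVecLin
  have h3 : Module.finrank ℝ (LinearMap.range Xᵀ.mulVecLin) = n := h1
  have h4 : Module.finrank ℝ (LinearMap.ker Xᵀ.mulVecLin) = 0 := by
    rw [h3, Module.finrank_fin_fun] at h2
    omega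
  have h5 := Submodule.finrank_eq_zero.mp h4
  have h6 : v ∈ LinearMap.ker Xᵀ.mulVecLin := by
    rw [LinearMap.mem_ker, mulVecLin_apply, hv]
  rw [h5] at h6
  exact (Submodule.mem_bot ℝ).mp h6

theorem aux_block {p q : ℕ} (A : Matrix (Fin p) (Fin p) ℝ) (B : Matrix (Fin p) (Fin q) ℝ)
    (C : Matrix (Fin q) (Fin p) ℝ) (D : Matrix (Fin q) (Fin q) ℝ)
    (h : (fromBlocks A B C D).PosSemidef) (v : Fin p → ℝ) (y : Fin q → ℝ) :
    0 ≤ v ⬝ᵥ A *ᵥ v + v ⬝ᵥ B *ᵥ y + (y ⬝ᵥ C *ᵥ v + y ⬝ᵥ D *ᵥ y) := by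
  have := h.dotProduct_mulVec_nonneg (Sum.elim v y)
  rw [fromBlocks_mulVec] at this
  simp only [star_trivial, sumElim_dotProduct_sumElim] at this
  simpa [dotProduct_add] using this

/-- The dual Lyapunov inequality obtained from the data LMIs. -/
theorem aux_lmi {n T : ℕ} (P M : Matrix (Fin n) (Fin n) ℝ) (X1 D0 : Matrix (Fin n) (Fin T) ℝ)
    (Q : Matrix (Fin T) (Fin n) ℝ) (α γ : ℝ) (hα : 0 < α)
    (hrank2 : X1.rank = n)
    (hass2 : (γ • (X1 * X1ᵀ) - D0 * D0ᵀ).PosSemidef)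
    (hP : P.PosDef)
    (hLMI1 : (fromBlocks (P - α • (X1 * X1ᵀ)) (X1 * Q) (Qᵀ * X1ᵀ) P).PosSemidef)
    (hLMI2 : (fromBlocks (1 : Matrix (Fin T) (Fin T) ℝ) Q Qᵀ P).PosSemidef)
    (hγα : γ < α ^ 2 / (4 + 2 * α))
    (hMP : M * P = (X1 - D0) * Q) (v : Fin n → ℝ) (hv : v ≠ 0) :
    (Mᵀ *ᵥ v) ⬝ᵥ P *ᵥ (Mᵀ *ᵥ v) < v ⬝ᵥ P *ᵥ v := by
  have hPT : Pᵀ = P := by simpa using hP.isHermitian.eq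
  have hdet : IsUnit P.det := (Matrix.isUnit_iff_isUnit_det P).mp hP.isUnit
  obtain ⟨w1, hw1⟩ : ∃ w, w = X1ᵀ *ᵥ v := ⟨_, rfl⟩
  obtain ⟨w2, hw2⟩ : ∃ w, w = D0ᵀ *ᵥ v := ⟨_, rfl⟩
  obtain ⟨y1, hy1⟩ : ∃ y, y = P⁻¹ *ᵥ (Qᵀ *ᵥ w1) := ⟨_, rfl⟩
  obtain ⟨y2, hy2⟩ : ∃ y, y = P⁻¹ *ᵥ (Qᵀ *ᵥ w2) := ⟨_, rfl⟩
  have hPy1 : Qᵀ *ᵥ w1 = P *ᵥ y1 := by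
    rw [hy1, mulVec_mulVec _ P, mul_nonsing_inv P hdet, one_mulVec]
  have hPy2 : Qᵀ *ᵥ w2 = P *ᵥ y2 := by
    rw [hy2, mulVec_mulVec _ P, mul_nonsing_inv P hdet, one_mulVec]
  have hMv : Mᵀ *ᵥ v = y1 - y2 := by
    have h1 : P * Mᵀ = Qᵀ * (X1 - D0)ᵀ := by
      have := congrArg transpose hMP
      rwa [transpose_mul, transpose_mul, hPT] at this
    have h2 : P *ᵥ (Mᵀ *ᵥ v) = P *ᵥ (y1 - y2) := by
      rw [mulVec_sub, ← hPy1, ← hPy2, mulVec_mulVec, h1, transpose_sub, ← mulVec_mulVec,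
        sub_mulVec, mulVec_sub, hw1, hw2]
    have h3 := congrArg (fun t => P⁻¹ *ᵥ t) h2
    simp only [mulVec_mulVec _ P⁻¹ P, nonsing_inv_mul P hdet, one_mulVec] at h3
    exact h3
  have tr : ∀ (w : Fin T → ℝ) (y : Fin n → ℝ), w ⬝ᵥ Q *ᵥ y = y ⬝ᵥ Qᵀ *ᵥ w := by
    intro w y
    rw [dotProduct_mulVec, ← mulVec_transpose, dotProduct_comm]
  have trX : ∀ (X : Matrix (Fin n) (Fin T) ℝ) (w : Fin T → ℝ), v ⬝ᵥ X *ᵥ w = (Xᵀ *ᵥ v) ⬝ᵥ w := by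
    intro X w
    rw [dotProduct_mulVec, ← mulVec_transpose]
  have sym : y2 ⬝ᵥ P *ᵥ y1 = y1 ⬝ᵥ P *ᵥ y2 := by
    rw [dotProduct_mulVec, ← mulVec_transpose, hPT, dotProduct_comm]
  have hs : 0 < w1 ⬝ᵥ w1 := by
    have hne : w1 ≠ 0 := fun h => hv (aux_inj X1 hrank2 v (by rw [← hw1, h]))
    have h0 : 0 ≤ w1 ⬝ᵥ w1 := Finset.sum_nonneg fun i _ => mul_self_nonneg _
    exact lt_of_le_of_ne h0 fun h => hne (dotProduct_self_eq_zero.mp h.symm)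
  have i1 := aux_block _ _ _ _ hLMI1 v (-y1)
  have i2 := aux_block _ _ _ _ hLMI2 w1 (-y1)
  have i3 := aux_block _ _ _ _ hLMI2 w2 (-y2)
  have i4 := hass2.dotProduct_mulVec_nonneg v
  have i5 := hP.posSemidef.dotProduct_mulVec_nonneg (α • y1 + (2 : ℝ) • y2)
  simp only [star_trivial, sub_mulVec, smul_mulVec, ← mulVec_mulVec, mulVec_neg, dotProduct_neg,
    neg_dotProduct, dotProduct_sub, dotProduct_smul, trX, ← hw1, ← hw2, tr, hPy1, hPy2,
    one_mulVec, smul_eq_mul, neg_neg, mulVec_add, mulVec_smul, add_dotProduct, smul_dotProduct,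
    dotProduct_add, sym] at i1 i2 i3 i4 i5
  rw [hMv]
  simp only [mulVec_sub, dotProduct_sub, sub_dotProduct, sym]
  rw [lt_div_iff₀ (by positivity)] at hγα
  generalize y1 ⬝ᵥ P *ᵥ y1 = a at *
  generalize y2 ⬝ᵥ P *ᵥ y2 = b at *
  generalize y1 ⬝ᵥ P *ᵥ y2 = d at *
  generalize w1 ⬝ᵥ w1 = s at *
  generalize w2 ⬝ᵥ w2 = t at *
  generalize v ⬝ᵥ P *ᵥ v = p at *
  have j1 : a ≤ p - α * s := by linarith
  have j2 : a ≤ s := by linarith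
  have j3 : b ≤ γ * s := by linarith
  have j5 : 0 ≤ α ^ 2 * a + 4 * α * d + 4 * b := by nlinarith
  have k1 : 2 * α * (a - 2 * d + b) ≤ 2 * α * a + α ^ 2 * a + 4 * b + 2 * α * b := by nlinarith
  have k2 : α ^ 2 * a ≤ α ^ 2 * s := by gcongr
  have k3 : (4 + 2 * α) * b ≤ (4 + 2 * α) * (γ * s) := by gcongr
  have k4 : γ * (4 + 2 * α) * s < α ^ 2 * s := by gcongr
  have k5 : 2 * α * a ≤ 2 * α * (p - α * s) := by gcongr
  have k6 : 2 * α * (a - 2 * d + b) < 2 * α * p := by nlinarith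
  have := lt_of_mul_lt_mul_left k6 (by positivity)
  linarith

/-- Passing from the dual to the primal Lyapunov inequality. -/
theorem aux_dual {n : ℕ} (P M : Matrix (Fin n) (Fin n) ℝ) (hP : P.PosDef)
    (h : ∀ v, v ≠ 0 → (Mᵀ *ᵥ v) ⬝ᵥ P *ᵥ (Mᵀ *ᵥ v) < v ⬝ᵥ P *ᵥ v)
    (x : Fin n → ℝ) (hx : x ≠ 0) :
    (M *ᵥ x) ⬝ᵥ P⁻¹ *ᵥ (M *ᵥ x) < x ⬝ᵥ P⁻¹ *ᵥ x := by
  have hPT : Pᵀ = P := by simpa using hP.isHermitian.eq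
  have hdet : IsUnit P.det := (Matrix.isUnit_iff_isUnit_det P).mp hP.isUnit
  have hPi : (P⁻¹).PosDef := hP.inv
  obtain ⟨v, hvd⟩ : ∃ v, v = P⁻¹ *ᵥ (M *ᵥ x) := ⟨_, rfl⟩
  obtain ⟨y, hyd⟩ : ∃ y, y = P⁻¹ *ᵥ x := ⟨_, rfl⟩
  have hPv : M *ᵥ x = P *ᵥ v := by
    rw [hvd, mulVec_mulVec _ P, mul_nonsing_inv P hdet, one_mulVec]
  have hPy : x = P *ᵥ y := by
    rw [hyd, mulVec_mulVec _ P, mul_nonsing_inv P hdet, one_mulVec]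
  have hpos : 0 < x ⬝ᵥ P⁻¹ *ᵥ x := by simpa using hPi.dotProduct_mulVec_pos hx
  rw [← hvd, ← hyd]
  by_cases hv : v = 0
  · rw [hv]
    simpa [hyd] using hpos
  have h1 := h v hv
  have h2 := hP.posSemidef.dotProduct_mulVec_nonneg (Mᵀ *ᵥ v - y)
  obtain ⟨w, hw⟩ : ∃ w, w = Mᵀ *ᵥ v := ⟨_, rfl⟩
  rw [← hw] at h1 h2
  have e1 : w ⬝ᵥ P *ᵥ y = (M *ᵥ x) ⬝ᵥ v := by
    rw [← hPy, hw, mulVec_transpose, ← dotProduct_mulVec, dotProduct_comm]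
  have e2 : y ⬝ᵥ P *ᵥ w = (M *ᵥ x) ⬝ᵥ v := by
    rw [← e1, dotProduct_mulVec, ← mulVec_transpose, hPT, dotProduct_comm]
  have e3 : v ⬝ᵥ P *ᵥ v = (M *ᵥ x) ⬝ᵥ v := by rw [← hPv, dotProduct_comm]
  have e4 : y ⬝ᵥ P *ᵥ y = x ⬝ᵥ y := by rw [← hPy, dotProduct_comm]
  simp only [star_trivial, mulVec_sub, dotProduct_sub, sub_dotProduct, e1, e2, e4] at h2
  rw [e3] at h1
  linarith

/-- Theorem 1 of the paper: if the data matrices of an experiment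
on the nonlinear system satisfy Assumptions 1 and 2 with constant `γ > 0`, and
`(Q, α)` with `α > 0` is feasible for the data LMIs with `γ < α²/(4 + 2α)`,
then `X₀Q` is invertible and `K = U₀Q(X₀Q)⁻¹` locally exponentially stabilizes
the origin of the closed loop `x(k+1) = f(x(k), Kx(k))`. -/
theorem data_driven_stabilization_nonlinear
    {n m T : ℕ}
    (f : (Fin n → ℝ) × (Fin m → ℝ) → (Fin n → ℝ))
    (hf : ContDiff ℝ 1 f) (hf0 : f (0, 0) = 0)
    (A : Matrix (Fin n) (Fin n) ℝ) (B : Matrix (Fin n) (Fin m) ℝ)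
    (hAB : ∀ xv uv, fderiv ℝ f (0, 0) (xv, uv) = A.mulVec xv + B.mulVec uv)
    (x0 : Fin n → ℝ) (u : ℕ → Fin m → ℝ) (x : ℕ → Fin n → ℝ)
    (hx0 : x 0 = x0) (hx : ∀ k, x (k + 1) = f (x k, u k))
    (U0 : Matrix (Fin m) (Fin T) ℝ)
    (X0 X1 D0 : Matrix (Fin n) (Fin T) ℝ)
    (hU0 : ∀ i (j : Fin T), U0 i j = u j i)
    (hX0 : ∀ i (j : Fin T), X0 i j = x j i)
    (hX1 : ∀ i (j : Fin T), X1 i j = x (j + 1) i)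
    (hD0 : ∀ i (j : Fin T),
      D0 i j = (f (x j, u j) - A.mulVec (x j) - B.mulVec (u j)) i)
    (γ : ℝ) (hγ : 0 < γ)
    (hrank1 : (fromRows U0 X0).rank = m + n)
    (hrank2 : X1.rank = n)
    (hass2 : (γ • (X1 * X1ᵀ) - D0 * D0ᵀ).PosSemidef)
    (Q : Matrix (Fin T) (Fin n) ℝ) (α : ℝ) (hα : 0 < α)
    (hLMI1 : (fromBlocks (X0 * Q - α • (X1 * X1ᵀ)) (X1 * Q)
        (Qᵀ * X1ᵀ) (X0 * Q)).PosSemidef)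
    (hLMI2 : (fromBlocks (1 : Matrix (Fin T) (Fin T) ℝ) Q
        Qᵀ (X0 * Q)).PosSemidef)
    (hγα : γ < α ^ 2 / (4 + 2 * α)) :
    IsUnit (X0 * Q) ∧
      ∀ K : Matrix (Fin m) (Fin n) ℝ, K = U0 * Q * (X0 * Q)⁻¹ →
        ∃ δ > (0 : ℝ), ∃ c > (0 : ℝ), ∃ ρ ∈ Set.Ioo (0 : ℝ) 1,
          ∀ z : ℕ → Fin n → ℝ,
            (∀ k, z (k + 1) = f (z k, K.mulVec (z k))) →
            ‖z 0‖ ≤ δ → ∀ k, ‖z k‖ ≤ c * ρ ^ k * ‖z 0‖ := by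
  have hPpsd : (X0 * Q).PosSemidef := by
    have := hLMI1.submatrix (Sum.inr : Fin n → Fin n ⊕ Fin n)
    exact this
  have hP : (X0 * Q).PosDef := by
    refine PosDef.of_dotProduct_mulVec_pos hPpsd.isHermitian fun v hv => ?_
    have i1 := aux_block _ _ _ _ hLMI1 v 0
    have e : v ⬝ᵥ (X1 * X1ᵀ) *ᵥ v = (X1ᵀ *ᵥ v) ⬝ᵥ (X1ᵀ *ᵥ v) := by
      rw [← mulVec_mulVec, dotProduct_mulVec, ← mulVec_transpose]
    simp only [sub_mulVec, smul_mulVec, mulVec_zero, dotProduct_zero,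
      zero_dotProduct, dotProduct_sub, dotProduct_smul, smul_eq_mul, e] at i1
    have hs : 0 < (X1ᵀ *ᵥ v) ⬝ᵥ (X1ᵀ *ᵥ v) := by
      have hne : X1ᵀ *ᵥ v ≠ 0 := fun h => hv (aux_inj X1 hrank2 v h)
      have h0 : 0 ≤ (X1ᵀ *ᵥ v) ⬝ᵥ (X1ᵀ *ᵥ v) := Finset.sum_nonneg fun i _ => mul_self_nonneg _
      exact lt_of_le_of_ne h0 fun h => hne (dotProduct_self_eq_zero.mp h.symm)
    have := mul_pos hα hs
    simp only [star_trivial]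
    linarith
  refine ⟨hP.isUnit, ?_⟩
  intro K hK
  have hdet : IsUnit (X0 * Q).det := (Matrix.isUnit_iff_isUnit_det _).mp hP.isUnit
  have hXX : X1 = A * X0 + B * U0 + D0 := by
    ext i j
    have e1 : (A * X0) i j = (A *ᵥ (x j)) i := by
      simp only [mul_apply, mulVec, dotProduct, hX0]
    have e2 : (B * U0) i j = (B *ᵥ (u j)) i := by
      simp only [mul_apply, mulVec, dotProduct, hU0]
    rw [Matrix.add_apply, Matrix.add_apply, e1, e2, hD0, hX1, hx]
    simp only [Pi.sub_apply]
    ring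
  have hMP : (A + B * K) * (X0 * Q) = (X1 - D0) * Q := by
    have e : K * (X0 * Q) = U0 * Q := by
      rw [hK, Matrix.mul_assoc, nonsing_inv_mul _ hdet, Matrix.mul_one]
    rw [hXX, add_sub_cancel_right, Matrix.add_mul, Matrix.mul_assoc B, e, Matrix.add_mul,
      Matrix.mul_assoc, Matrix.mul_assoc]
  have hdual := aux_dual (X0 * Q) (A + B * K) hP
    (aux_lmi (X0 * Q) (A + B * K) X1 D0 Q α γ hα hrank2 hass2 hP hLMI1 hLMI2 hγα hMP)
  refine aux_stab (fun z => f (z, K *ᵥ z)) (A + B * K) (X0 * Q)⁻¹ (by simpa using hf0) ?_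
    (fun y hy => by simpa using hP.inv.dotProduct_mulVec_pos hy) hdual
  intro ε hε
  have hd : HasFDerivAt f (fderiv ℝ f (0, 0)) (0, 0) :=
    (hf.differentiable (by norm_num) (0, 0)).hasFDerivAt
  have hlin : HasFDerivAt (fun z : Fin n → ℝ => (z, K *ᵥ z))
      ((ContinuousLinearMap.id ℝ (Fin n → ℝ)).prod (LinearMap.toContinuousLinearMap K.mulVecLin))
      0 :=
    (hasFDerivAt_id _).prodMk (LinearMap.toContinuousLinearMap K.mulVecLin).hasFDerivAt
  have hcomp := HasFDerivAt.comp (g := f) (g' := fderiv ℝ f (0, 0)) (0 : Fin n → ℝ)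
    (by simpa using hd) hlin
  have hlo := hcomp.isLittleO.def hε
  obtain ⟨r, hr, hball⟩ := Metric.eventually_nhds_iff.mp hlo
  refine ⟨r / 2, by positivity, fun z hz => ?_⟩
  have := hball (y := z) (by rw [dist_zero_right]; linarith)
  simpa [hAB, hf0, add_mulVec, mulVec_mulVec] using this
end

section
/- Consider the linear system x(k+1) = Ax(k) + Bu(k) with A ∈ ℝ^{n×n}, B ∈ ℝ^{n×m} and the pair (A,B) controllable. Let the data matrices U₀, X₀, X₁ be generated by an experiment from any initial state x₀ with an input sequence u(0),…,u(T−1) that is persistently exciting of order n+1. Then: (a) the stacked matrix [U₀; X₀] has full row rank m+n and X₁ has full row rank n; (b) there exists a feasible pair (Q, α) for the data LMIs with α > 0; and (c) for every feasible pair (Q, α) with α > 0, the matrix X₀Q is invertible and the gain K := U₀Q(X₀Q)⁻¹ satisfies that all eigenvalues of A + BK have modulus strictly less than 1. -/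
open Matrix

theorem rank_eq_card_iff_ker {ι κ : Type*} [Fintype ι] [Fintype κ] (M : Matrix ι κ ℝ) :
    M.rank = Fintype.card ι ↔ ∀ v, v ᵥ* M = 0 → v = 0 := by
  have h1 : M.rank = Fintype.card ι ↔ LinearIndependent ℝ M.row := by
    rw [linearIndependent_iff_card_eq_finrank_span, rank_eq_finrank_span_row, eq_comm, Set.finrank]
  rw [h1, ← Matrix.vecMul_injective_iff]
  constructor
  · intro h v hv
    apply h
    simpa using hv
  · intro h v w hvw
    have := h (v - w) (by rw [Matrix.sub_vecMul]; exact sub_eq_zero.2 hvw)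
    exact sub_eq_zero.1 this

theorem exists_right_of_rank {ι κ : Type*} [Fintype ι] [Fintype κ] [DecidableEq ι] [DecidableEq κ]
    (M : Matrix ι κ ℝ)
    (h : M.rank = Fintype.card ι) : ∃ R : Matrix κ ι ℝ, M * R = 1 := by
  rw [← mulVec_surjective_iff_exists_right_inverse]
  have : LinearMap.range M.mulVecLin = ⊤ := by
    apply Submodule.eq_top_of_finrank_eq
    rw [← Matrix.rank, h]; simp
  exact LinearMap.range_eq_top.1 this

theorem sol_formula {n m : ℕ}
    (A : Matrix (Fin n) (Fin n) ℝ) (B : Matrix (Fin n) (Fin m) ℝ)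
    (u : ℕ → Fin m → ℝ) (x : ℕ → Fin n → ℝ)
    (hx : ∀ k, x (k + 1) = A.mulVec (x k) + B.mulVec (u k)) (j i : ℕ) :
    x (j + i) = (A ^ i) *ᵥ x j + ∑ l ∈ Finset.range i, (A ^ (i - 1 - l) * B) *ᵥ u (j + l) := by
  induction i with
  | zero => simp
  | succ i ih =>
    rw [← add_assoc, hx, ih, Finset.sum_range_succ, mulVec_add, mulVec_mulVec, ← pow_succ', mulVec_sum]
    have : ∀ l ∈ Finset.range i, A *ᵥ ((A ^ (i - 1 - l) * B) *ᵥ u (j + l))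
        = (A ^ (i + 1 - 1 - l) * B) *ᵥ u (j + l) := by
      intro l hl
      rw [Finset.mem_range] at hl
      rw [mulVec_mulVec, ← Matrix.mul_assoc, ← pow_succ']
      congr 3; omega
    rw [Finset.sum_congr rfl this]
    simp [add_assoc]

theorem ctrb_ker {n m : ℕ}
    (A : Matrix (Fin n) (Fin n) ℝ) (B : Matrix (Fin n) (Fin m) ℝ)
    (hctrb : (Matrix.of fun (i : Fin n) (p : Fin n × Fin m) =>
        (A ^ (p.1 : ℕ) * B) i p.2).rank = n) (v : Fin n → ℝ)
    (hv : ∀ i < n, v ᵥ* (A ^ i * B) = 0) : v = 0 := by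
  have := (rank_eq_card_iff_ker (Matrix.of fun (i : Fin n) (p : Fin n × Fin m) =>
        (A ^ (p.1 : ℕ) * B) i p.2)).1 (by simpa using hctrb) v
  apply this
  ext p
  exact congrFun (hv p.1 p.1.2) p.2

theorem fundamental {n m T : ℕ}
    (A : Matrix (Fin n) (Fin n) ℝ) (B : Matrix (Fin n) (Fin m) ℝ)
    (hctrb : (Matrix.of fun (i : Fin n) (p : Fin n × Fin m) =>
        (A ^ (p.1 : ℕ) * B) i p.2).rank = n)
    (u : ℕ → Fin m → ℝ)
    (hPE : (Matrix.of fun (p : Fin (n + 1) × Fin m) (j : Fin (T - n)) =>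
        u ((p.1 : ℕ) + (j : ℕ)) p.2).rank = m * (n + 1))
    (x : ℕ → Fin n → ℝ)
    (hx : ∀ k, x (k + 1) = A.mulVec (x k) + B.mulVec (u k))
    (ξ : Fin m → ℝ) (η : Fin n → ℝ) (h0 : ∀ k < T, ξ ⬝ᵥ u k + η ⬝ᵥ x k = 0) :
    ξ = 0 ∧ η = 0 := by
  let h : ℕ → Fin m → ℝ := fun d => Nat.casesOn d ξ (fun d => η ᵥ* (A ^ d * B))
  let c : ℕ → ℝ := fun i => A.charpoly.coeff i
  have hc : c n = 1 := by
    have := A.charpoly_monic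
    rw [Polynomial.Monic, Polynomial.leadingCoeff, charpoly_natDegree_eq_dim] at this
    simpa using this
  have hCH : ∑ i ∈ Finset.range (n + 1), c i • A ^ i = 0 := by
    rw [← A.aeval_self_charpoly, Polynomial.aeval_eq_sum_range, charpoly_natDegree_eq_dim]
    simp [c]
  let g : ℕ → ℕ → Fin m → ℝ := fun i l => if l ≤ i then h (i - l) else 0
  have hg : ∀ j < T - n, ∀ i ≤ n,
      ∑ l ∈ Finset.range (n + 1), g i l ⬝ᵥ u (j + l) = - (η ⬝ᵥ ((A ^ i) *ᵥ x j)) := by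
    intro j hj i hi
    have e := h0 (j + i) (by omega)
    rw [sol_formula A B u x hx j i, dotProduct_add, dotProduct_sum] at e
    have e1 : ∑ l ∈ Finset.range (n + 1), g i l ⬝ᵥ u (j + l)
        = ∑ l ∈ Finset.range (i + 1), g i l ⬝ᵥ u (j + l) := by
      symm
      apply Finset.sum_subset
      · intro a ha; simp at ha ⊢; omega
      · intro a _ ha
        simp at ha
        simp [g, show ¬ a ≤ i by omega]
    rw [e1, Finset.sum_range_succ]
    have e2 : ∀ l ∈ Finset.range i, g i l ⬝ᵥ u (j + l) = η ⬝ᵥ (A ^ (i - 1 - l) * B) *ᵥ u (j + l) := by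
      intro l hl
      rw [Finset.mem_range] at hl
      rw [dotProduct_mulVec]
      have : i - l = (i - 1 - l) + 1 := by omega
      simp only [g, if_pos hl.le, this, h]
    rw [Finset.sum_congr rfl e2]
    have e3 : g i i = ξ := by simp [g, h]
    rw [e3]; linarith
  let w : ℕ → Fin m → ℝ := fun l => ∑ i ∈ Finset.range (n + 1), c i • g i l
  have hw : ∀ j < T - n, ∑ l ∈ Finset.range (n + 1), w l ⬝ᵥ u (j + l) = 0 := by
    intro j hj
    simp only [w, sum_dotProduct, smul_dotProduct]
    rw [Finset.sum_comm]
    have : ∀ i ∈ Finset.range (n + 1), ∑ l ∈ Finset.range (n + 1), c i • (g i l ⬝ᵥ u (j + l))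
        = - (η ⬝ᵥ ((c i • A ^ i) *ᵥ x j)) := by
      intro i hi
      rw [← Finset.smul_sum, hg j hj i (by simp at hi; omega), smul_mulVec, dotProduct_smul]
      simp
    rw [Finset.sum_congr rfl this, Finset.sum_neg_distrib, ← dotProduct_sum, ← sum_mulVec, hCH]
    simp
  have hw0 : ∀ l ≤ n, w l = 0 := by
    have key := (rank_eq_card_iff_ker (Matrix.of fun (p : Fin (n + 1) × Fin m) (j : Fin (T - n)) =>
        u ((p.1 : ℕ) + (j : ℕ)) p.2)).1 (by rw [hPE]; simp [mul_comm]) (fun p => w p.1 p.2) (by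
        ext j
        have := hw j j.2
        rw [← Fin.sum_univ_eq_sum_range (fun l => w l ⬝ᵥ u (j + l))] at this
        simp only [vecMul, dotProduct, Fintype.sum_prod_type, Matrix.of_apply, Pi.zero_apply]
        rw [← this]
        simp only [dotProduct, add_comm])
    intro l hl
    ext a
    exact congrFun key (⟨l, by omega⟩, a)
  have hh : ∀ d ≤ n, h d = 0 := by
    intro d
    induction d using Nat.strong_induction_on with
    | _ d ih =>
      intro hd
      have e := hw0 (n - d) (by omega)
      simp only [w] at e
      rw [Finset.sum_range_succ, Finset.sum_eq_zero, hc] at e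
      · have : n - (n - d) = d := by omega
        simpa [g, this] using e
      · intro i hi
        simp at hi
        simp only [g]
        split_ifs with hif
        · rw [ih _ (by omega) (by omega)]; simp
        · simp
  refine ⟨hh 0 (by omega), ctrb_ker A B hctrb η ?_⟩
  intro i hi
  exact hh (i + 1) (by omega)

theorem small_posSemidef {ι κ : Type*} [Fintype ι] [Fintype κ] [DecidableEq ι] (M : Matrix ι κ ℝ) :
    ∃ c : ℝ, 0 < c ∧ (1 - c • (M * Mᵀ)).PosSemidef := by
  let s : ℝ := ∑ j, ∑ i, M i j ^ 2
  have hs : 0 ≤ s := Finset.sum_nonneg fun _ _ => Finset.sum_nonneg fun _ _ => sq_nonneg _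
  refine ⟨1 / (1 + s), by positivity, ?_⟩
  apply PosSemidef.of_dotProduct_mulVec_nonneg
  · rw [IsHermitian, conjTranspose_eq_transpose_of_trivial]
    simp [transpose_mul]
  · intro v
    rw [sub_mulVec, dotProduct_sub, one_mulVec, smul_mulVec, dotProduct_smul, ← mulVec_mulVec,
      dotProduct_mulVec, star_trivial, ← mulVec_transpose]
    have hb : (Mᵀ *ᵥ v) ⬝ᵥ (Mᵀ *ᵥ v) ≤ s * (v ⬝ᵥ v) := by
      simp only [s, Finset.sum_mul]
      rw [dotProduct]
      apply Finset.sum_le_sum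
      intro j _
      have := Finset.sum_mul_sq_le_sq_mul_sq Finset.univ (fun i => M i j) v
      simp only [mulVec, dotProduct, transpose_apply, ← pow_two]
      rw [← Finset.sum_mul]
      exact this
    have hv : 0 ≤ v ⬝ᵥ v := by
      rw [dotProduct]; exact Finset.sum_nonneg fun i _ => mul_self_nonneg _
    rw [smul_eq_mul, sub_nonneg, one_div, inv_mul_le_iff₀ (by positivity)]
    nlinarith

theorem posSemidef_block_diag₁ {ι κ : Type*} [Fintype ι] [Fintype κ] [DecidableEq ι]
    {D : Matrix ι ι ℝ}
    (hD : D.PosSemidef) : (fromBlocks D 0 0 (0 : Matrix κ κ ℝ)).PosSemidef := by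
  have := hD.mul_mul_conjTranspose_same (fromRows (1 : Matrix ι ι ℝ) (0 : Matrix κ ι ℝ))
  rw [conjTranspose_eq_transpose_of_trivial, transpose_fromRows, fromRows_mul,
    fromRows_mul_fromCols] at this
  simpa using this

theorem posSemidef_block_diag₂ {ι κ : Type*} [Fintype ι] [Fintype κ] [DecidableEq κ]
    {D : Matrix κ κ ℝ}
    (hD : D.PosSemidef) : (fromBlocks (0 : Matrix ι ι ℝ) 0 0 D).PosSemidef := by
  have := hD.mul_mul_conjTranspose_same (fromRows (0 : Matrix ι κ ℝ) (1 : Matrix κ κ ℝ))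
  rw [conjTranspose_eq_transpose_of_trivial, transpose_fromRows, fromRows_mul,
    fromRows_mul_fromCols] at this
  simpa using this

theorem posSemidef_block_gram {ι κ τ : Type*} [Fintype ι] [Fintype κ] [Fintype τ]
    (E : Matrix ι τ ℝ) (F : Matrix κ τ ℝ) :
    (fromBlocks (E * Eᵀ) (E * Fᵀ) (F * Eᵀ) (F * Fᵀ)).PosSemidef := by
  have := posSemidef_self_mul_conjTranspose (fromRows E F)
  rwa [conjTranspose_eq_transpose_of_trivial, transpose_fromRows, fromRows_mul_fromCols] at this

theorem exists_lyap {n m : ℕ}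
    (A : Matrix (Fin n) (Fin n) ℝ) (B : Matrix (Fin n) (Fin m) ℝ)
    (hctrb : (Matrix.of fun (i : Fin n) (p : Fin n × Fin m) =>
        (A ^ (p.1 : ℕ) * B) i p.2).rank = n) :
    ∃ (P : Matrix (Fin n) (Fin n) ℝ) (Y : Matrix (Fin m) (Fin n) ℝ),
      Pᵀ = P ∧ (P - 1).PosSemidef ∧
      (fromBlocks (P - 1) (A * P + B * Y) (A * P + B * Y)ᵀ P).PosSemidef := by
  rcases Nat.eq_zero_or_pos n with hn | hn
  · subst hn
    refine ⟨1, 0, by simp, by simpa using PosSemidef.zero, ?_⟩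
    convert PosSemidef.zero using 1
    exact Subsingleton.elim _ _
  have : NeZero n := ⟨hn.ne'⟩
  obtain ⟨R, hR⟩ := exists_right_of_rank _ (hctrb.trans (Fintype.card_fin n).symm)
  let G : Matrix (Fin n × Fin m) (Fin n) ℝ := - (R * A ^ n)
  let Γ : ℕ → Matrix (Fin m) (Fin n) ℝ := fun k =>
    Matrix.of fun a b => G (Fin.ofNat n (n - 1 - k), a) b
  let Φ : ℕ → Matrix (Fin n) (Fin n) ℝ := fun k =>
    Nat.rec 1 (fun k F => A * F + B * Γ k) k
  have hΦs : ∀ k, Φ (k + 1) = A * Φ k + B * Γ k := fun k => rfl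
  have hΦ0 : Φ 0 = 1 := rfl
  have hΦ : ∀ i, Φ i = A ^ i + ∑ l ∈ Finset.range i, A ^ (i - 1 - l) * B * Γ l := by
    intro i
    induction i with
    | zero => simp [hΦ0]
    | succ i ih =>
      rw [hΦs, ih, Finset.sum_range_succ, mul_add, ← pow_succ', Finset.mul_sum]
      have : ∀ l ∈ Finset.range i, A * (A ^ (i - 1 - l) * B * Γ l)
          = A ^ (i + 1 - 1 - l) * B * Γ l := by
        intro l hl
        rw [Finset.mem_range] at hl
        rw [← Matrix.mul_assoc, ← Matrix.mul_assoc, ← pow_succ']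
        congr 3; omega
      rw [Finset.sum_congr rfl this]
      simp [add_assoc]
  have hΦn : Φ n = 0 := by
    have e : (Matrix.of fun (i : Fin n) (p : Fin n × Fin m) =>
        (A ^ (p.1 : ℕ) * B) i p.2) * G = - A ^ n := by
      simp only [G]
      rw [Matrix.mul_neg, ← Matrix.mul_assoc, hR, Matrix.one_mul]
    rw [hΦ, ← Finset.sum_range_reflect]
    have : ∑ j ∈ Finset.range n, A ^ (n - 1 - (n - 1 - j)) * B * Γ (n - 1 - j)
        = (Matrix.of fun (i : Fin n) (p : Fin n × Fin m) => (A ^ (p.1 : ℕ) * B) i p.2) * G := by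
      rw [← Fin.sum_univ_eq_sum_range
        (fun j => A ^ (n - 1 - (n - 1 - j)) * B * Γ (n - 1 - j))]
      ext a b
      rw [Matrix.sum_apply, Matrix.mul_apply, Fintype.sum_prod_type]
      apply Finset.sum_congr rfl
      intro j _
      rw [Matrix.mul_apply]
      apply Finset.sum_congr rfl
      intro q _
      have h1 : n - 1 - (n - 1 - (j : ℕ)) = j := by omega
      have h2 : Fin.ofNat n (j : ℕ) = j := by
        ext; simp [Fin.ofNat, Nat.mod_eq_of_lt j.2]
      simp only [Γ, h1, Matrix.of_apply, h2]
    rw [this, e]; simp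
  let P := ∑ k ∈ Finset.range n, Φ k * (Φ k)ᵀ
  let Y := ∑ k ∈ Finset.range n, Γ k * (Φ k)ᵀ
  have hP1 : P - 1 = ∑ k ∈ Finset.range n, Φ (k + 1) * (Φ (k + 1))ᵀ := by
    have a1 := Finset.sum_range_succ (fun k => Φ k * (Φ k)ᵀ) n
    have a2 := Finset.sum_range_succ' (fun k => Φ k * (Φ k)ᵀ) n
    rw [a2, hΦ0, hΦn] at a1
    simp only [P]
    rw [sub_eq_iff_eq_add]
    simpa using a1.symm
  have hF : A * P + B * Y = ∑ k ∈ Finset.range n, Φ (k + 1) * (Φ k)ᵀ := by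
    simp only [P, Y, Matrix.mul_sum, ← Finset.sum_add_distrib, hΦs, Matrix.add_mul, Matrix.mul_assoc]
  refine ⟨P, Y, by simp [P, transpose_sum], ?_, ?_⟩
  · rw [hP1]
    apply posSemidef_sum
    intro k _
    simpa using posSemidef_self_mul_conjTranspose (Φ (k + 1))
  · have : fromBlocks (P - 1) (A * P + B * Y) (A * P + B * Y)ᵀ P
      = ∑ k ∈ Finset.range n, fromBlocks (Φ (k + 1) * (Φ (k + 1))ᵀ) (Φ (k + 1) * (Φ k)ᵀ)
        (Φ k * (Φ (k + 1))ᵀ) (Φ k * (Φ k)ᵀ) := by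
      rw [hF, hP1]
      ext (i | i) (j | j) <;> simp [P, Matrix.sum_apply, transpose_sum]
    rw [this]
    exact posSemidef_sum _ fun k _ => posSemidef_block_gram _ _

theorem lmi_feasible {n T : ℕ}
    (X0 X1 : Matrix (Fin n) (Fin T) ℝ) (P F : Matrix (Fin n) (Fin n) ℝ)
    (R : Matrix (Fin T) (Fin n) ℝ) (hP : (P - 1).PosSemidef)
    (hF : (fromBlocks (P - 1) F Fᵀ P).PosSemidef) (h0 : X0 * R = P) (h1 : X1 * R = F) :
    ∃ (Q : Matrix (Fin T) (Fin n) ℝ) (α : ℝ), 0 < α ∧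
      (fromBlocks (X0 * Q - α • (X1 * X1ᵀ)) (X1 * Q)
        (Qᵀ * X1ᵀ) (X0 * Q)).PosSemidef ∧
      (fromBlocks (1 : Matrix (Fin T) (Fin T) ℝ) Q Qᵀ (X0 * Q)).PosSemidef := by
  obtain ⟨e, he, hE⟩ := small_posSemidef Rᵀ
  obtain ⟨c, hc, hC⟩ := small_posSemidef X1
  refine ⟨e • R, e * c, by positivity, ?_, ?_⟩
  · have : fromBlocks (X0 * (e • R) - (e * c) • (X1 * X1ᵀ)) (X1 * (e • R))
        ((e • R)ᵀ * X1ᵀ) (X0 * (e • R)) = e • (fromBlocks (P - 1) F Fᵀ P +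
          fromBlocks (1 - c • (X1 * X1ᵀ)) 0 0 0) := by
      rw [fromBlocks_add, fromBlocks_smul, ← transpose_mul]
      simp only [Matrix.mul_smul, h0, h1, transpose_smul, add_zero]
      congr 1
      rw [mul_smul, ← smul_sub]; congr 1; abel
    rw [this]
    exact (hF.add (posSemidef_block_diag₁ hC)).smul he.le
  · have : fromBlocks (1 : Matrix (Fin T) (Fin T) ℝ) (e • R) (e • R)ᵀ (X0 * (e • R))
       = fromBlocks ((1 : Matrix (Fin T) (Fin T) ℝ) * (1 : Matrix (Fin T) (Fin T) ℝ)ᵀ) ((1 : Matrix (Fin T) (Fin T) ℝ) * (e • R)ᵀᵀ) ((e • R)ᵀ * (1 : Matrix (Fin T) (Fin T) ℝ)ᵀ)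
          ((e • R)ᵀ * (e • R)ᵀᵀ) + fromBlocks 0 0 0 (e • ((P - 1) + (1 - e • (Rᵀ * Rᵀᵀ)))) := by
      rw [fromBlocks_add]
      simp only [Matrix.mul_smul, h0, transpose_smul, transpose_transpose, transpose_one,
        Matrix.mul_one, Matrix.one_mul, add_zero, Matrix.smul_mul]
      congr 1
      rw [← smul_add]; congr 1; abel
    rw [this]
    exact (posSemidef_block_gram _ _).add (posSemidef_block_diag₂ ((hP.add hE).smul he.le))

theorem lmi_stable {n : ℕ}
    (P F W : Matrix (Fin n) (Fin n) ℝ) (hW : ∀ v, v ≠ 0 → 0 < v ⬝ᵥ W *ᵥ v)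
    (hP : ∀ v, v ≠ 0 → 0 < v ⬝ᵥ P *ᵥ v) (hPt : Pᵀ = P)
    (h : (fromBlocks (P - W) (F * P) (F * P)ᵀ P).PosSemidef) :
    ∀ μ ∈ spectrum ℂ (F.map (Complex.ofReal)), ‖μ‖ < 1 := by
  intro μ hμ
  have key : ∀ v, v ⬝ᵥ W *ᵥ v + (Fᵀ *ᵥ v) ⬝ᵥ P *ᵥ (Fᵀ *ᵥ v) ≤ v ⬝ᵥ P *ᵥ v := by
    intro v
    have := h.dotProduct_mulVec_nonneg (Sum.elim v (- (Fᵀ *ᵥ v)))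
    rw [star_trivial, fromBlocks_mulVec] at this
    simp only [sumElim_dotProduct_sumElim, Sum.elim_comp_inl, Sum.elim_comp_inr, mulVec_neg, dotProduct_neg,
      neg_dotProduct, dotProduct_add, sub_mulVec, dotProduct_sub, transpose_mul, hPt] at this
    have e1 : v ⬝ᵥ (F * P) *ᵥ (Fᵀ *ᵥ v) = (Fᵀ *ᵥ v) ⬝ᵥ P *ᵥ (Fᵀ *ᵥ v) := by
      rw [← mulVec_mulVec, dotProduct_mulVec, ← mulVec_transpose]
    rw [e1, ← mulVec_mulVec v P] at this
    linarith
  have hμ' : μ ∈ spectrum ℂ ((F.map Complex.ofReal)ᵀ) := by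
    rw [mem_spectrum_iff_isRoot_charpoly] at hμ ⊢
    rwa [charpoly_transpose]
  rw [← spectrum_toLin', ← Module.End.hasEigenvalue_iff_mem_spectrum] at hμ'
  obtain ⟨z, hz⟩ := hμ'.exists_hasEigenvector
  have hz1 := hz.apply_eq_smul
  have hz0 := hz.2
  rw [toLin'_apply] at hz1
  let a : Fin n → ℝ := fun i => (z i).re
  let b : Fin n → ℝ := fun i => (z i).im
  have ha : Fᵀ *ᵥ a = μ.re • a - μ.im • b := by
    ext i
    have := congrArg Complex.re (congrFun hz1 i)
    simpa [mulVec, dotProduct, a, b, Complex.mul_re] using this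
  have hb : Fᵀ *ᵥ b = μ.im • a + μ.re • b := by
    ext i
    have := congrArg Complex.im (congrFun hz1 i)
    simpa [mulVec, dotProduct, a, b, Complex.mul_im, add_comm] using this
  have ka := key a
  have kb := key b
  rw [ha] at ka
  rw [hb] at kb
  simp only [mulVec_sub, mulVec_add, mulVec_smul, dotProduct_sub, dotProduct_add, sub_dotProduct,
    add_dotProduct, smul_dotProduct, dotProduct_smul, smul_eq_mul] at ka kb
  have hWn : ∀ v, 0 ≤ v ⬝ᵥ W *ᵥ v := by
    intro v
    by_cases hv : v = 0
    · simp [hv]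
    · exact (hW v hv).le
  have hPn : ∀ v, 0 ≤ v ⬝ᵥ P *ᵥ v := by
    intro v
    by_cases hv : v = 0
    · simp [hv]
    · exact (hP v hv).le
  have hab : a ≠ 0 ∨ b ≠ 0 := by
    by_contra! hcon
    apply hz0
    ext i
    apply Complex.ext
    · exact congrFun hcon.1 i
    · exact congrFun hcon.2 i
  have hWp : 0 < a ⬝ᵥ W *ᵥ a + b ⬝ᵥ W *ᵥ b := by
    rcases hab with h | h
    · have := hW _ h; have := hWn b; linarith
    · have := hW _ h; have := hWn a; linarith
  have hlt : (μ.re ^ 2 + μ.im ^ 2) * (a ⬝ᵥ P *ᵥ a + b ⬝ᵥ P *ᵥ b)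
      < 1 * (a ⬝ᵥ P *ᵥ a + b ⬝ᵥ P *ᵥ b) := by nlinarith
  have h2 := lt_of_mul_lt_mul_right hlt (add_nonneg (hPn a) (hPn b))
  have h3 : ‖μ‖ ^ 2 < 1 := by
    rw [Complex.sq_norm, Complex.normSq_apply]; nlinarith
  nlinarith [norm_nonneg μ]



/-- Theorem 2 of the paper: for a controllable linear system and
an experiment with a persistently exciting input of order `n+1`:
(a) `[U₀; X₀]` has full row rank `m + n` and `X₁` has full row rank `n`;
(b) the data LMIs admit a feasible pair `(Q, α)` with `α > 0`;
(c) every feasible pair with `α > 0` yields an invertible `X₀Q` and a gain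
`K = U₀Q(X₀Q)⁻¹` placing all eigenvalues of `A + BK` strictly inside the unit
circle. -/
theorem data_driven_stabilization_linear
    {n m T : ℕ}
    (A : Matrix (Fin n) (Fin n) ℝ) (B : Matrix (Fin n) (Fin m) ℝ)
    (hctrb : (Matrix.of fun (i : Fin n) (p : Fin n × Fin m) =>
        (A ^ (p.1 : ℕ) * B) i p.2).rank = n)
    (x0 : Fin n → ℝ) (u : ℕ → Fin m → ℝ)
    (hPE : (Matrix.of fun (p : Fin (n + 1) × Fin m) (j : Fin (T - n)) =>
        u ((p.1 : ℕ) + (j : ℕ)) p.2).rank = m * (n + 1))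
    (x : ℕ → Fin n → ℝ)
    (hx0 : x 0 = x0) (hx : ∀ k, x (k + 1) = A.mulVec (x k) + B.mulVec (u k))
    (U0 : Matrix (Fin m) (Fin T) ℝ)
    (X0 X1 : Matrix (Fin n) (Fin T) ℝ)
    (hU0 : ∀ i (j : Fin T), U0 i j = u j i)
    (hX0 : ∀ i (j : Fin T), X0 i j = x j i)
    (hX1 : ∀ i (j : Fin T), X1 i j = x (j + 1) i) :
    ((fromRows U0 X0).rank = m + n ∧ X1.rank = n) ∧
    (∃ (Q : Matrix (Fin T) (Fin n) ℝ) (α : ℝ), 0 < α ∧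
      (fromBlocks (X0 * Q - α • (X1 * X1ᵀ)) (X1 * Q)
        (Qᵀ * X1ᵀ) (X0 * Q)).PosSemidef ∧
      (fromBlocks (1 : Matrix (Fin T) (Fin T) ℝ) Q Qᵀ (X0 * Q)).PosSemidef) ∧
    (∀ (Q : Matrix (Fin T) (Fin n) ℝ) (α : ℝ), 0 < α →
      (fromBlocks (X0 * Q - α • (X1 * X1ᵀ)) (X1 * Q)
        (Qᵀ * X1ᵀ) (X0 * Q)).PosSemidef →
      (fromBlocks (1 : Matrix (Fin T) (Fin T) ℝ) Q Qᵀ (X0 * Q)).PosSemidef →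
      IsUnit (X0 * Q) ∧
        ∀ K : Matrix (Fin m) (Fin n) ℝ, K = U0 * Q * (X0 * Q)⁻¹ →
          ∀ μ ∈ spectrum ℂ ((A + B * K).map (Complex.ofReal)), ‖μ‖ < 1) := by
  have hfund := fundamental A B hctrb u hPE x hx
  have hX1eq : X1 = A * X0 + B * U0 := by
    ext i j
    rw [hX1, hx]
    simp [Matrix.mul_apply, mulVec, dotProduct, hX0, hU0]
  have hX1ker : ∀ v, v ᵥ* X1 = 0 → v = 0 := by
    intro v hv
    have := hfund (v ᵥ* B) (v ᵥ* A) (by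
      intro k hk
      have e := congrFun hv ⟨k, hk⟩
      have e' : v ⬝ᵥ x (k + 1) = 0 := by
        rw [← Pi.zero_apply (M := fun _ : Fin T => ℝ) ⟨k, hk⟩, ← e]
        simp [vecMul, dotProduct, hX1]
      rw [hx, dotProduct_add, dotProduct_mulVec, dotProduct_mulVec] at e'
      rw [add_comm]; exact e')
    apply ctrb_ker A B hctrb
    intro i _
    cases i with
    | zero => simpa using this.1
    | succ i => rw [pow_succ', Matrix.mul_assoc, ← vecMul_vecMul, this.2, zero_vecMul]
  have hrank : (fromRows U0 X0).rank = m + n := by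
    have := (rank_eq_card_iff_ker (fromRows U0 X0)).2 (by
      intro v hv
      have h := hfund (v ∘ Sum.inl) (v ∘ Sum.inr) (by
        intro k hk
        have e := congrFun hv ⟨k, hk⟩
        rw [vecMul_fromRows] at e
        simpa [vecMul, dotProduct, hU0, hX0] using e)
      ext (i | i)
      · exact congrFun h.1 i
      · exact congrFun h.2 i)
    simpa using this
  refine ⟨⟨hrank, ?_⟩, ?_, ?_⟩
  · simpa using (rank_eq_card_iff_ker X1).2 hX1ker
  · obtain ⟨P, Y, hPt, hP1, hF⟩ := exists_lyap A B hctrb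
    obtain ⟨S, hS⟩ := exists_right_of_rank (fromRows U0 X0) (by simpa using hrank)
    have e : fromRows (U0 * (S * fromRows Y P)) (X0 * (S * fromRows Y P)) = fromRows Y P := by
      rw [← fromRows_mul, ← Matrix.mul_assoc, hS, Matrix.one_mul]
    rw [fromRows_ext_iff] at e
    refine lmi_feasible X0 X1 P _ (S * fromRows Y P) hP1 hF e.2 ?_
    rw [hX1eq, Matrix.add_mul, Matrix.mul_assoc, Matrix.mul_assoc, e.1, e.2]
  · intro Q α hα h1 h2
    have hPt : (X0 * Q)ᵀ = X0 * Q := by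
      have := h1.isHermitian
      rw [IsHermitian, conjTranspose_eq_transpose_of_trivial, fromBlocks_transpose,
        fromBlocks_inj] at this
      exact this.2.2.2
    have hW : ∀ v, v ≠ 0 → 0 < v ⬝ᵥ (α • (X1 * X1ᵀ)) *ᵥ v := by
      intro v hv
      rw [smul_mulVec, dotProduct_smul, ← mulVec_mulVec, dotProduct_mulVec, mulVec_transpose,
        smul_eq_mul]
      apply mul_pos hα
      have hne : v ᵥ* X1 ≠ 0 := fun h => hv (hX1ker v h)
      have := dotProduct_star_self_pos_iff.2 hne
      simpa using this
    have hP : ∀ v, v ≠ 0 → 0 < v ⬝ᵥ (X0 * Q) *ᵥ v := by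
      intro v hv
      have := h1.dotProduct_mulVec_nonneg (Sum.elim v 0)
      rw [star_trivial, fromBlocks_mulVec] at this
      simp only [sumElim_dotProduct_sumElim, Sum.elim_comp_inl, Sum.elim_comp_inr, mulVec_zero,
        zero_dotProduct, add_zero, sub_mulVec, dotProduct_sub] at this
      have := hW v hv
      linarith
    have hu : IsUnit (X0 * Q) :=
      (PosDef.of_dotProduct_mulVec_pos (by
        rw [IsHermitian, conjTranspose_eq_transpose_of_trivial, hPt])
        (fun v hv => by simpa using hP v hv)).isUnit
    refine ⟨hu, ?_⟩
    rintro K rfl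
    apply lmi_stable (X0 * Q) _ (α • (X1 * X1ᵀ)) hW hP hPt
    have hdet := (isUnit_iff_isUnit_det _).1 hu
    have e : (A + B * (U0 * Q * (X0 * Q)⁻¹)) * (X0 * Q) = X1 * Q := by
      rw [Matrix.add_mul, Matrix.mul_assoc B, Matrix.mul_assoc (U0 * Q), nonsing_inv_mul _ hdet,
        Matrix.mul_one, hX1eq, Matrix.add_mul]
      simp only [Matrix.mul_assoc]
    rw [e, transpose_mul]
    exact h1
end

section
/- Let θ ∈ ℝ with θ ≠ 0 and θ ≠ −1. Define the inputs u(0) = θ, u(1) = θ + θ², u(2) = θ + θ² + (θ + θ²)², and the nonlinear trajectory x(0) = θ, x(k+1) = x(k)² + u(k). Then: (a) the input is persistently exciting of order 2, i.e. the Hankel matrix [[u(0), u(1)],[u(1), u(2)]] is nonsingular; (b) the 2×3 matrix with first row (u(0), u(1), u(2)) and second row (x(0), x(1), x(2)) has rank exactly 1; (c) for the linearized trajectory x^l(0) = θ, x^l(k+1) = u(k), the 2×3 matrix with first row (u(0), u(1), u(2)) and second row (x^l(0), x^l(1), x^l(2)) has rank 2. Hence an experiment with a persistently exciting input arbitrarily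 close to the equilibrium can fail to produce a full-row-rank data matrix [U₀; X₀] for the nonlinear system even though the corresponding data matrix of the linearized system has full row rank. -/
open Matrix

/-- the example `x(k+1) = x(k)² + u(k)` with the particular
persistently exciting input built from `θ`: the Hankel matrix of the input is
nonsingular (persistency of excitation of order 2), the nonlinear data matrix
`[U₀; X₀]` has rank exactly 1, while the linearized data matrix has rank 2. -/
theorem nonlinear_experiment_rank_deficiency
    (θ : ℝ) (hθ0 : θ ≠ 0) (hθ1 : θ ≠ -1)
    (u x xl : ℕ → ℝ)
    (hu0 : u 0 = θ) (hu1 : u 1 = θ + θ ^ 2)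
    (hu2 : u 2 = θ + θ ^ 2 + (θ + θ ^ 2) ^ 2)
    (hx0 : x 0 = θ) (hx : ∀ k, x (k + 1) = (x k) ^ 2 + u k)
    (hxl0 : xl 0 = θ) (hxl : ∀ k, xl (k + 1) = u k) :
    (!![u 0, u 1; u 1, u 2]).det ≠ 0 ∧
    (!![u 0, u 1, u 2; x 0, x 1, x 2]).rank = 1 ∧
    (!![u 0, u 1, u 2; xl 0, xl 1, xl 2]).rank = 2 := by
  have hx1 : x 1 = θ + θ ^ 2 := by rw [hx 0, hx0, hu0]; ring
  have hx2 : x 2 = θ + θ ^ 2 + (θ + θ ^ 2) ^ 2 := by rw [hx 1, hx1, hu1]; ring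
  have hl1 : xl 1 = θ := by rw [hxl 0, hu0]
  have hl2 : xl 2 = θ + θ ^ 2 := by rw [hxl 1, hu1]
  have h1 : 1 + θ ≠ 0 := fun h => hθ1 (by linarith)
  rw [hu0, hu1, hu2, hx0, hx1, hx2, hxl0, hl1, hl2]
  refine ⟨?_, ?_, ?_⟩
  · rw [Matrix.det_fin_two_of]
    have : θ * (θ + θ ^ 2 + (θ + θ ^ 2) ^ 2) - (θ + θ ^ 2) * (θ + θ ^ 2)
        = θ ^ 4 * (1 + θ) := by ring
    rw [this]
    exact mul_ne_zero (pow_ne_zero _ hθ0) h1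
  · apply le_antisymm
    · have : !![θ, θ + θ ^ 2, θ + θ ^ 2 + (θ + θ ^ 2) ^ 2;
          θ, θ + θ ^ 2, θ + θ ^ 2 + (θ + θ ^ 2) ^ 2]
          = vecMulVec ![1, 1] ![θ, θ + θ ^ 2, θ + θ ^ 2 + (θ + θ ^ 2) ^ 2] := by
        ext i j
        fin_cases i <;> fin_cases j <;> simp [vecMulVec_apply]
      rw [this]
      exact rank_vecMulVec_le _ _
    · refine le_trans ?_ (Matrix.rank_submatrix_le _ (fun _ : Fin 1 => 0) (fun _ : Fin 1 => 0))
      rw [Matrix.rank_of_isUnit]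
      · simp
      · rw [Matrix.isUnit_iff_isUnit_det]
        simpa using hθ0
  · have hli : LinearIndependent ℝ
        (!![θ, θ + θ ^ 2, θ + θ ^ 2 + (θ + θ ^ 2) ^ 2; θ, θ, θ + θ ^ 2]).row := by
      rw [Fintype.linearIndependent_iff]
      intro g h
      have e0 := congrFun h 0
      have e1 := congrFun h 1
      simp [Fin.sum_univ_two, Matrix.row] at e0 e1
      have k0 : g 0 = 0 := by
        have : θ ^ 2 * g 0 = 0 := by linear_combination e1 - e0
        exact (mul_eq_zero.mp this).resolve_left (pow_ne_zero _ hθ0)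
      have k1 : g 1 = 0 := by
        rw [k0] at e0
        simpa [hθ0] using e0
      intro i
      fin_cases i
      · exact k0
      · exact k1
    simpa using hli.rank_matrix
end

section
/- Let X^l, Ψ, D ∈ ℝ^{n×T}, ε > 0 and γ > 0. If (γε²/2) X^l (X^l)ᵀ ⪰ γ ΨΨᵀ + DDᵀ in the Loewner order, then DDᵀ ⪯ γ X₁X₁ᵀ where X₁ := εX^l + Ψ; that is, the data matrix X₁ of the scaled nonlinear experiment satisfies Assumption 2 with constant γ. -/
open Matrix

/-- sufficiency of the scaled condition for Assumption 2:
if `(γε²/2) Xˡ(Xˡ)ᵀ ⪰ γΨΨᵀ + DDᵀ` then `DDᵀ ⪯ γ X₁X₁ᵀ` for `X₁ = εXˡ + Ψ`. -/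
theorem scaled_experiment_assumption2
    {n T : ℕ} (Xl Ψ D : Matrix (Fin n) (Fin T) ℝ) (ε γ : ℝ)
    (hε : 0 < ε) (hγ : 0 < γ)
    (h : ((γ * ε ^ 2 / 2) • (Xl * Xlᵀ) - (γ • (Ψ * Ψᵀ) + D * Dᵀ)).PosSemidef) :
    (γ • ((ε • Xl + Ψ) * (ε • Xl + Ψ)ᵀ) - D * Dᵀ).PosSemidef := by
  have h2 : ((γ / 2) • ((ε • Xl + (2:ℝ) • Ψ) * (ε • Xl + (2:ℝ) • Ψ)ᵀ)).PosSemidef := by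
    have h3 := Matrix.posSemidef_self_mul_conjTranspose (ε • Xl + (2:ℝ) • Ψ)
    rw [Matrix.conjTranspose_eq_transpose_of_trivial] at h3
    exact h3.smul (by positivity)
  convert h.add h2 using 1
  simp only [Matrix.transpose_add, Matrix.transpose_smul, Matrix.add_mul, Matrix.mul_add,
    Matrix.smul_mul, Matrix.mul_smul]
  module
end

section
/- Let f : ℝⁿ × ℝᵐ → ℝⁿ be continuously differentiable with f(0,0) = 0, let A := ∂f/∂x(0,0), B := ∂f/∂u(0,0), and suppose the pair (A,B) is controllable. Fix any experiment (x₀, u(0),…,u(T−1)) whose input is persistently exciting of order n+1. Then for every γ > 0 there exists ε̄ > 0 such that, for all ε ∈ (0, ε̄), the data matrices Ũ₀, X̃₀, X̃₁, D̃₀ generated by the scaled experiment (εx₀, εu(0),…,εu(T−1)) on the nonlinear system satisfy: (i) the stacked matrix [Ũ₀; X̃₀] has full row rank m+n and X̃₁ has full row rank n, and (ii) D̃₀D̃₀ᵀ ⪯ γ X̃₁X̃₁ᵀ in the Loewner order. -/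
open Matrix

open Filter Topology

lemma rank_full_iff {p q : Type*} [Fintype p] [Fintype q] (M : Matrix p q ℝ) :
    M.rank = Fintype.card p ↔ ∀ v : p → ℝ, v ᵥ* M = 0 → v = 0 := by
  have h1 : LinearIndependent ℝ M.row ↔ ∀ v : p → ℝ, v ᵥ* M = 0 → v = 0 := by
    rw [← Matrix.vecMul_injective_iff]
    exact injective_iff_map_eq_zero (Matrix.vecMulLinear M)
  rw [← h1, linearIndependent_iff_card_eq_finrank_span, Matrix.rank_eq_finrank_span_row,
    eq_comm]
  rfl

lemma rank_full_iff_det {p q : Type*} [Fintype p] [Fintype q] [DecidableEq p]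
    (M : Matrix p q ℝ) :
    M.rank = Fintype.card p ↔ (M * Mᵀ).det ≠ 0 := by
  rw [← Matrix.rank_self_mul_transpose, rank_full_iff]
  constructor
  · intro h hd
    obtain ⟨v, hv, hv0⟩ := Matrix.exists_vecMul_eq_zero_iff.mpr hd
    exact hv (h v hv0)
  · intro h v hv
    by_contra hne
    exact h (Matrix.exists_vecMul_eq_zero_iff.mp ⟨v, hne, hv⟩)

lemma rank_eventually {α : Type*} {l : Filter α} {p q : Type*} [Fintype p] [Fintype q]
    (F : α → Matrix p q ℝ) (M : Matrix p q ℝ) (hF : Tendsto F l (𝓝 M))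
    (hM : M.rank = Fintype.card p) : ∀ᶠ a in l, (F a).rank = Fintype.card p := by
  classical
  simp only [rank_full_iff_det] at *
  have hc : Continuous fun N : Matrix p q ℝ => (N * Nᵀ).det := by fun_prop
  exact ((hc.tendsto M).comp hF).eventually_ne hM

lemma posSemidef_eventually {α : Type*} {l : Filter α} {n : ℕ}
    (F : α → Matrix (Fin n) (Fin n) ℝ) (M : Matrix (Fin n) (Fin n) ℝ)
    (hF : Tendsto F l (𝓝 M)) (hs : ∀ a, (F a).IsHermitian)
    (hM : ∀ v : Fin n → ℝ, v ≠ 0 → 0 < v ⬝ᵥ (M *ᵥ v)) :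
    ∀ᶠ a in l, (F a).PosSemidef := by
  have hc : Continuous fun N : Matrix (Fin n) (Fin n) ℝ × (Fin n → ℝ) =>
      N.2 ⬝ᵥ (N.1 *ᵥ N.2) := by fun_prop
  have key : ∀ᶠ N in 𝓝 M, ∀ v ∈ Metric.sphere (0 : Fin n → ℝ) 1, 0 < v ⬝ᵥ (N *ᵥ v) := by
    apply (isCompact_sphere (0 : Fin n → ℝ) 1).eventually_forall_of_forall_eventually
    intro v hv
    have hv0 : v ≠ 0 := by
      rintro rfl
      simp at hv
    exact (hc.tendsto (M, v)).eventually (lt_mem_nhds (hM v hv0))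
  filter_upwards [hF.eventually key] with a ha
  refine Matrix.PosSemidef.of_dotProduct_mulVec_nonneg (hs a) fun v => ?_
  by_cases hv : v = 0
  · simp [hv]
  have hn : 0 < ‖v‖ := norm_pos_iff.mpr hv
  have h1 := ha (‖v‖⁻¹ • v) (by simp [norm_smul, hn.ne'])
  rw [Matrix.mulVec_smul, smul_dotProduct, dotProduct_smul, smul_eq_mul, smul_eq_mul] at h1
  have h2 : 0 < v ⬝ᵥ (F a *ᵥ v) := by
    have hi : 0 < ‖v‖⁻¹ := inv_pos.mpr hn
    exact (mul_pos_iff_of_pos_left hi).mp ((mul_pos_iff_of_pos_left hi).mp h1)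
  simpa using h2.le

lemma willems {n m T : ℕ} 
    (A : Matrix (Fin n) (Fin n) ℝ) (B : Matrix (Fin n) (Fin m) ℝ)
    (hctrb : ∀ ξ : Fin n → ℝ, (∀ k < n, ξ ᵥ* (A ^ k * B) = 0) → ξ = 0)
    (u : ℕ → Fin m → ℝ)
    (hPE : ∀ c : ℕ → Fin m → ℝ,
      (∀ k < T - n, ∑ i ∈ Finset.range (n + 1), c i ⬝ᵥ u (i + k) = 0) → ∀ i ≤ n, c i = 0)
    (x : ℕ → Fin n → ℝ) (hx : ∀ k, x (k + 1) = A *ᵥ x k + B *ᵥ u k)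
    (η : Fin m → ℝ) (ξ : Fin n → ℝ) (h : ∀ k < T, η ⬝ᵥ u k + ξ ⬝ᵥ x k = 0) :
    η = 0 ∧ ξ = 0 := by
  -- solution formula
  have hsol : ∀ j k, ξ ⬝ᵥ x (j + k) = ξ ⬝ᵥ (A ^ j *ᵥ x k) +
      ∑ i ∈ Finset.range j, (ξ ᵥ* (A ^ (j - 1 - i) * B)) ⬝ᵥ u (i + k) := by
    intro j
    induction j with
    | zero => intro k; simp
    | succ j ih =>
      intro k
      have := ih (k + 1)
      rw [Finset.sum_range_succ']
      rw [show j + 1 + k = j + (k + 1) by ring, this, hx, Matrix.mulVec_add,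
        Matrix.mulVec_mulVec, ← pow_succ, dotProduct_add, add_assoc]
      congr 1
      rw [add_comm]
      congr 1
      · apply Finset.sum_congr rfl
        intro i hi
        rw [show j + 1 - 1 - (i + 1) = j - 1 - i by omega,
          show i + 1 + k = i + (k + 1) by ring]
      · simp [Matrix.mulVec_mulVec, Matrix.dotProduct_mulVec]
  set α : ℕ → ℝ := fun j => A.charpoly.coeff j with hα
  have hdeg : A.charpoly.natDegree = n := by
    simp
  have hαn : α n = 1 := by
    have := A.charpoly_monic.coeff_natDegree
    rwa [hdeg] at this
  have hCH : ∑ j ∈ Finset.range (n + 1), α j • A ^ j = 0 := by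
    have := A.aeval_self_charpoly
    rw [Polynomial.aeval_eq_sum_range, hdeg] at this
    exact this
  set c : ℕ → Fin m → ℝ := fun i => α i • η +
    ∑ j ∈ Finset.range (n + 1), if i < j then α j • (ξ ᵥ* (A ^ (j - 1 - i) * B)) else 0 with hc
  have hc0 : ∀ i ≤ n, c i = 0 := by
    apply hPE
    intro k hk
    have e : ∑ j ∈ Finset.range (n + 1), α j * (η ⬝ᵥ u (j + k) + ξ ⬝ᵥ x (j + k)) = 0 := by
      apply Finset.sum_eq_zero
      intro j hj
      rw [h _ (by simp at hj; omega), mul_zero]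
    have e2 : ∑ j ∈ Finset.range (n + 1), α j * (ξ ⬝ᵥ (A ^ j *ᵥ x k)) = 0 := by
      have : ξ ⬝ᵥ ((∑ j ∈ Finset.range (n + 1), α j • A ^ j) *ᵥ x k) = 0 := by
        rw [hCH]; simp
      rw [Matrix.sum_mulVec, dotProduct_sum] at this
      simpa [Matrix.smul_mulVec] using this
    simp only [hsol, mul_add, Finset.sum_add_distrib, e2, zero_add] at e
    simp only [hc, add_dotProduct, Finset.sum_add_distrib, smul_dotProduct, smul_eq_mul]
    rw [← e]
    congr 1
    simp only [sum_dotProduct]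
    rw [Finset.sum_comm]
    apply Finset.sum_congr rfl
    intro j hj
    rw [Finset.mul_sum]
    simp only [Finset.mem_range] at hj
    have hsub : Finset.range j ⊆ Finset.range (n + 1) := by
      intro a; simp; omega
    rw [← Finset.sum_subset hsub]
    · apply Finset.sum_congr rfl
      intro i hi
      rw [if_pos (by simpa using hi), smul_dotProduct, smul_eq_mul]
    · intro i _ hi
      rw [if_neg (by simpa using hi), zero_dotProduct]
  have hη : η = 0 := by
    have := hc0 n le_rfl
    simp only [hc, hαn, one_smul] at this
    rwa [Finset.sum_eq_zero, add_zero] at this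
    intro j hj
    rw [if_neg (by simp at hj; omega)]
  refine ⟨hη, hctrb ξ ?_⟩
  intro k
  induction k using Nat.strong_induction_on with
  | _ k ih =>
    intro hk
    have := hc0 (n - 1 - k) (by omega)
    simp only [hc, hη, smul_zero, zero_add] at this
    rw [Finset.sum_eq_single n] at this
    · rwa [if_pos (by omega), hαn, one_smul, show n - 1 - (n - 1 - k) = k by omega] at this
    · intro j hj hjn
      simp only [Finset.mem_range] at hj
      split_ifs with hij
      · rw [ih _ (by omega) (by omega), smul_zero]
      · rfl
    · simp

/-- Theorem 3 of the paper: for a controllable linearization and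
any experiment with a persistently exciting input of order `n+1`, for every
`γ > 0` there is `ε̄ > 0` such that for all `ε ∈ (0, ε̄)` the data of the
scaled experiment `(εx₀, εu)` on the nonlinear system satisfy Assumptions 1
and 2. -/
theorem scaled_experiments_satisfy_assumptions
    {n m T : ℕ}
    (f : (Fin n → ℝ) × (Fin m → ℝ) → (Fin n → ℝ))
    (hf : ContDiff ℝ 1 f) (hf0 : f (0, 0) = 0)
    (A : Matrix (Fin n) (Fin n) ℝ) (B : Matrix (Fin n) (Fin m) ℝ)
    (hAB : ∀ xv uv, fderiv ℝ f (0, 0) (xv, uv) = A.mulVec xv + B.mulVec uv)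
    (hctrb : (Matrix.of fun (i : Fin n) (p : Fin n × Fin m) =>
        (A ^ (p.1 : ℕ) * B) i p.2).rank = n)
    (x0 : Fin n → ℝ) (u : ℕ → Fin m → ℝ)
    (hPE : (Matrix.of fun (p : Fin (n + 1) × Fin m) (j : Fin (T - n)) =>
        u ((p.1 : ℕ) + (j : ℕ)) p.2).rank = m * (n + 1))
    (xt : ℝ → ℕ → Fin n → ℝ)
    (hxt0 : ∀ ε : ℝ, xt ε 0 = ε • x0)
    (hxt : ∀ (ε : ℝ) (k : ℕ), xt ε (k + 1) = f (xt ε k, ε • u k))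
    (Ut : ℝ → Matrix (Fin m) (Fin T) ℝ)
    (X0t X1t D0t : ℝ → Matrix (Fin n) (Fin T) ℝ)
    (hUt : ∀ (ε : ℝ) i (j : Fin T), Ut ε i j = ε * u j i)
    (hX0t : ∀ (ε : ℝ) i (j : Fin T), X0t ε i j = xt ε j i)
    (hX1t : ∀ (ε : ℝ) i (j : Fin T), X1t ε i j = xt ε (j + 1) i)
    (hD0t : ∀ (ε : ℝ) i (j : Fin T), D0t ε i j =
      (f (xt ε j, ε • u j) - A.mulVec (xt ε j) - B.mulVec (ε • u j)) i) :
    ∀ γ > (0 : ℝ), ∃ εb > (0 : ℝ), ∀ ε ∈ Set.Ioo (0 : ℝ) εb,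
      ((fromRows (Ut ε) (X0t ε)).rank = m + n ∧ (X1t ε).rank = n) ∧
      (γ • (X1t ε * (X1t ε)ᵀ) - D0t ε * (D0t ε)ᵀ).PosSemidef := by
  classical
  have hctrb' : ∀ ξ : Fin n → ℝ, (∀ k < n, ξ ᵥ* (A ^ k * B) = 0) → ξ = 0 := by
    have h := (rank_full_iff (Matrix.of fun (i : Fin n) (p : Fin n × Fin m) =>
        (A ^ (p.1 : ℕ) * B) i p.2)).mp (by rw [hctrb, Fintype.card_fin])
    intro ξ hξ
    apply h
    funext p
    exact congrFun (hξ p.1 p.1.2) p.2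
  have hPE' : ∀ c : ℕ → Fin m → ℝ,
      (∀ k < T - n, ∑ i ∈ Finset.range (n + 1), c i ⬝ᵥ u (i + k) = 0) →
        ∀ i ≤ n, c i = 0 := by
    have h := (rank_full_iff (Matrix.of fun (p : Fin (n + 1) × Fin m) (j : Fin (T - n)) =>
        u ((p.1 : ℕ) + (j : ℕ)) p.2)).mp (by rw [hPE]; simp [mul_comm])
    intro c hc i hi
    have h0 := h (fun p => c p.1 p.2) (by
      funext j
      have := hc j j.2
      rw [Finset.sum_range] at this
      simpa [Matrix.vecMul, dotProduct, Fintype.sum_prod_type] using this)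
    funext q
    exact congrFun h0 (⟨i, by omega⟩, q)
  -- the linearized trajectory
  let x : ℕ → Fin n → ℝ := fun k => Nat.rec x0 (fun k y => A *ᵥ y + B *ᵥ u k) k
  have hx0 : x 0 = x0 := rfl
  have hx : ∀ k, x (k + 1) = A *ᵥ x k + B *ᵥ u k := fun k => rfl
  have hW := fun η ξ => willems (T := T) A B hctrb' u hPE' x hx η ξ
  -- trajectory at zero scaling
  have hz : ∀ k, xt 0 k = 0 := by
    intro k
    induction k with
    | zero => simp [hxt0]
    | succ k ih => rw [hxt, ih, zero_smul, hf0]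
  -- derivative of the trajectory in the scaling
  have hlin : ∀ k, HasDerivAt (fun ε : ℝ => ε • u k) (u k) 0 := by
    intro k
    simpa using (hasDerivAt_id (0 : ℝ)).smul_const (u k)
  have hder : ∀ k, HasDerivAt (fun ε => xt ε k) (x k) 0 := by
    intro k
    induction k with
    | zero =>
      simp only [hxt0, hx0]
      simpa using (hasDerivAt_id (0 : ℝ)).smul_const x0
    | succ k ih =>
      have hfd : HasFDerivAt f (fderiv ℝ f (0, 0)) ((fun ε : ℝ => (xt ε k, ε • u k)) 0) := by
        simp only [hz, zero_smul]
        exact (hf.differentiable (by simp) (0, 0)).hasFDerivAt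
      have := hfd.comp_hasDerivAt (0 : ℝ) (ih.prodMk (hlin k))
      rw [hAB, ← hx] at this
      simp only [hxt]
      exact this
  have hlim : ∀ k, Tendsto (fun ε : ℝ => ε⁻¹ • xt ε k) (𝓝[>] 0) (𝓝 (x k)) := by
    intro k
    simpa [hz] using (hder k).tendsto_slope_zero_right
  -- limits of the scaled data matrices
  let X0 : Matrix (Fin n) (Fin T) ℝ := Matrix.of fun i j => x j i
  let X1 : Matrix (Fin n) (Fin T) ℝ := Matrix.of fun i j => x (j + 1) i
  let U0 : Matrix (Fin m) (Fin T) ℝ := Matrix.of fun i j => u j i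
  have hpos : ∀ᶠ ε : ℝ in 𝓝[>] 0, 0 < ε := self_mem_nhdsWithin
  have hl1 : Tendsto (fun ε : ℝ => ε⁻¹ • X1t ε) (𝓝[>] 0) (𝓝 X1) := by
    refine tendsto_pi_nhds.mpr fun i => tendsto_pi_nhds.mpr fun j => ?_
    simpa [hX1t, X1] using (tendsto_pi_nhds.mp (hlim (j + 1))) i
  have hlD : Tendsto (fun ε : ℝ => ε⁻¹ • D0t ε) (𝓝[>] 0) (𝓝 0) := by
    refine tendsto_pi_nhds.mpr fun i => tendsto_pi_nhds.mpr fun j => ?_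
    have hcA : Continuous fun y : Fin n → ℝ => A *ᵥ y := by fun_prop
    have h1 := ((hlim (j + 1)).sub ((hcA.tendsto _).comp (hlim j))).sub
      (tendsto_const_nhds (x := B *ᵥ u j))
    rw [hx, add_sub_cancel_left, sub_self] at h1
    have h2 := (tendsto_pi_nhds.mp h1) i
    refine Tendsto.congr' ?_ h2
    filter_upwards [hpos] with ε hε
    simp only [Function.comp, Pi.sub_apply, Matrix.smul_apply, hD0t, hxt, Matrix.mulVec_smul,
      Pi.smul_apply, smul_eq_mul]
    field_simp
  have hlS : Tendsto (fun ε : ℝ => ε⁻¹ • fromRows (Ut ε) (X0t ε)) (𝓝[>] 0)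
      (𝓝 (fromRows U0 X0)) := by
    refine tendsto_pi_nhds.mpr fun i => tendsto_pi_nhds.mpr fun j => ?_
    rcases i with i | i
    · refine Tendsto.congr' ?_ (tendsto_const_nhds (x := u j i))
      filter_upwards [hpos] with ε hε
      simp [hUt, hε.ne']
    · simpa [hX0t, X0] using (tendsto_pi_nhds.mp (hlim j)) i
  -- ranks of the limits
  have hker1 : ∀ v : Fin n → ℝ, v ᵥ* X1 = 0 → v = 0 := by
    intro v hv
    obtain ⟨hB, hA⟩ := hW (v ᵥ* B) (v ᵥ* A) (by
      intro k hk
      have := congrFun hv ⟨k, hk⟩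
      change v ⬝ᵥ x (k + 1) = 0 at this
      rw [hx, dotProduct_add, dotProduct_mulVec, dotProduct_mulVec] at this
      rw [add_comm]; exact this)
    apply hctrb'
    intro k _
    rcases k with _ | k
    · simpa using hB
    · rw [pow_succ', Matrix.mul_assoc, ← Matrix.vecMul_vecMul, hA, Matrix.zero_vecMul]
  have hr1 : X1.rank = Fintype.card (Fin n) := (rank_full_iff X1).mpr hker1
  have hrS : (fromRows U0 X0).rank = Fintype.card (Fin m ⊕ Fin n) := by
    rw [rank_full_iff]
    intro v hv
    obtain ⟨h1, h2⟩ := hW (v ∘ Sum.inl) (v ∘ Sum.inr) (by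
      intro k hk
      have := congrFun hv ⟨k, hk⟩
      simpa [Matrix.vecMul, dotProduct, Fintype.sum_sum_type, U0, X0] using this)
    funext i
    rcases i with i | i
    · exact congrFun h1 i
    · exact congrFun h2 i
  intro γ hγ
  have hlP : Tendsto (fun ε : ℝ => γ • ((ε⁻¹ • X1t ε) * (ε⁻¹ • X1t ε)ᵀ) -
      (ε⁻¹ • D0t ε) * (ε⁻¹ • D0t ε)ᵀ) (𝓝[>] 0) (𝓝 (γ • (X1 * X1ᵀ))) := by
    have hc : Continuous fun N : Matrix (Fin n) (Fin T) ℝ × Matrix (Fin n) (Fin T) ℝ =>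
        γ • (N.1 * N.1ᵀ) - N.2 * N.2ᵀ := by fun_prop
    have := (hc.tendsto (X1, 0)).comp (hl1.prodMk_nhds hlD)
    simpa [Function.comp_def] using this
  have e1 := rank_eventually _ _ hlS hrS
  have e2 := rank_eventually _ _ hl1 hr1
  have e3 := posSemidef_eventually _ _ hlP
    (by
      intro ε
      rw [Matrix.IsHermitian, Matrix.conjTranspose_eq_transpose_of_trivial]
      simp only [Matrix.transpose_sub, Matrix.transpose_smul, Matrix.transpose_mul,
        Matrix.transpose_transpose])
    (by
      intro v hv
      rw [Matrix.smul_mulVec, dotProduct_smul, smul_eq_mul, ← Matrix.mulVec_mulVec,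
        Matrix.dotProduct_mulVec, Matrix.mulVec_transpose]
      refine mul_pos hγ (lt_of_le_of_ne ?_ ?_)
      · exact Finset.sum_nonneg fun i _ => mul_self_nonneg _
      · intro h0
        exact hv (hker1 v (dotProduct_self_eq_zero.mp h0.symm)))
  obtain ⟨εb, hεb, hsub⟩ := mem_nhdsGT_iff_exists_Ioo_subset.mp (e1.and (e2.and e3))
  refine ⟨εb, hεb, fun ε hε => ?_⟩
  obtain ⟨h1, h2, h3⟩ := hsub hε
  have hε0 : (0 : ℝ) < ε := hε.1
  have hnz : ε⁻¹ ∈ nonZeroDivisors ℝ := mem_nonZeroDivisors_of_ne_zero (inv_ne_zero hε0.ne')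
  rw [Matrix.rank_smul_of_mem_nonZeroDivisors _ hnz] at h1 h2
  refine ⟨⟨by simpa using h1, by simpa using h2⟩, ?_⟩
  have h4 := h3.smul (sq_nonneg ε)
  convert h4 using 1
  simp only [Matrix.transpose_smul, Matrix.smul_mul, Matrix.mul_smul, smul_sub, smul_smul]
  congr 2 <;> field_simp
  rw [one_smul]
end

section
/- Let X₀ ∈ ℝ^{n×T} and Q ∈ ℝ^{T×n} be such that X₀Q is symmetric positive definite. Then there exists δ̄ > 0 such that for all δ ∈ (0, δ̄], the matrix I_T − δQ(X₀Q)⁻¹Qᵀ is positive definite, and consequently the block matrix [[I_T, δQ],[δQᵀ, X₀(δQ)]] is symmetric positive semidefinite; i.e., the second data LMI is satisfied by Q̂ := δQ for all sufficiently small δ > 0. -/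
open Matrix

theorem quad_bound {T : ℕ} (M : Matrix (Fin T) (Fin T) ℝ) (x : Fin T → ℝ) :
    x ⬝ᵥ (M *ᵥ x) ≤ (∑ i, ∑ j, |M i j|) * (x ⬝ᵥ x) := by
  have hc : ∀ i, x i * x i ≤ x ⬝ᵥ x := fun i =>
    Finset.single_le_sum (f := fun i => x i * x i) (fun j _ => mul_self_nonneg _)
      (Finset.mem_univ i)
  rw [Finset.sum_mul]
  refine Finset.sum_le_sum fun i _ => ?_
  rw [Finset.sum_mul]
  simp only [mulVec]
  rw [dotProduct, Finset.mul_sum]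
  refine Finset.sum_le_sum fun j _ => ?_
  have h1 : |x i * x j| ≤ x ⬝ᵥ x := by
    have := hc i
    have := hc j
    rw [abs_le]
    constructor <;> nlinarith [sq_nonneg (x i - x j), sq_nonneg (x i + x j)]
  calc x i * (M i j * x j) = M i j * (x i * x j) := by ring
    _ ≤ |M i j * (x i * x j)| := le_abs_self _
    _ = |M i j| * |x i * x j| := abs_mul _ _
    _ ≤ _ := mul_le_mul_of_nonneg_left h1 (abs_nonneg _)

/-- if `X₀Q ≻ 0` then for all sufficiently small `δ > 0` the
matrix `I_T − δ Q (X₀Q)⁻¹ Qᵀ` is positive definite and the second data LMI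
holds for `Q̂ := δQ`. -/
theorem second_LMI_small_scaling
    {n T : ℕ} (X0 : Matrix (Fin n) (Fin T) ℝ) (Q : Matrix (Fin T) (Fin n) ℝ)
    (h : (X0 * Q).PosDef) :
    ∃ δb > (0 : ℝ), ∀ δ ∈ Set.Ioc (0 : ℝ) δb,
      ((1 : Matrix (Fin T) (Fin T) ℝ) - δ • (Q * (X0 * Q)⁻¹ * Qᵀ)).PosDef ∧
      (fromBlocks (1 : Matrix (Fin T) (Fin T) ℝ) (δ • Q)
        (δ • Q)ᵀ (X0 * (δ • Q))).PosSemidef := by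
  have hM : (Q * (X0 * Q)⁻¹ * Qᵀ).PosSemidef := by
    simpa using h.inv.posSemidef.mul_mul_conjTranspose_same Q
  have hb := quad_bound (Q * (X0 * Q)⁻¹ * Qᵀ)
  have hC : 0 ≤ ∑ i, ∑ j, |(Q * (X0 * Q)⁻¹ * Qᵀ) i j| := by positivity
  generalize (∑ i, ∑ j, |(Q * (X0 * Q)⁻¹ * Qᵀ) i j|) = C at hb hC
  refine ⟨1 / (C + 1), by positivity, fun δ ⟨h0, h1⟩ => ?_⟩
  have h2 : δ * (C + 1) ≤ 1 := by rwa [le_div_iff₀ (by positivity)] at h1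
  have hP : ((1 : Matrix (Fin T) (Fin T) ℝ) - δ • (Q * (X0 * Q)⁻¹ * Qᵀ)).PosDef := by
    refine PosDef.of_dotProduct_mulVec_pos
      (isHermitian_one.sub (hM.smul h0.le).isHermitian) fun x hx => ?_
    have hx' : 0 < x ⬝ᵥ x := by
      simpa using (PosDef.one (n := Fin T) (R := ℝ)).dotProduct_mulVec_pos hx
    have := hb x
    simp only [star_trivial, sub_mulVec, one_mulVec, smul_mulVec, dotProduct_sub,
      dotProduct_smul, smul_eq_mul]
    nlinarith [mul_le_mul_of_nonneg_left this h0.le, mul_pos h0 hx']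
  refine ⟨hP, ?_⟩
  have hD : (X0 * (δ • Q)).PosDef := by
    rw [Matrix.mul_smul]; exact h.smul h0
  haveI : Invertible (X0 * (δ • Q)) := hD.isUnit.invertible
  have key := (PosDef.fromBlocks₂₂ (1 : Matrix (Fin T) (Fin T) ℝ) (δ • Q) hD).2
  rw [conjTranspose_eq_transpose_of_trivial] at key
  apply key
  have hu : IsUnit (X0 * Q).det := (isUnit_iff_isUnit_det _).1 h.isUnit
  have hinv : (X0 * (δ • Q))⁻¹ = δ⁻¹ • (X0 * Q)⁻¹ := by
    apply inv_eq_right_inv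
    simp only [Matrix.mul_smul, Matrix.smul_mul, smul_smul]
    rw [mul_nonsing_inv _ hu, inv_mul_cancel₀ h0.ne', one_smul]
  have e : (δ • Q) * (X0 * (δ • Q))⁻¹ * (δ • Q)ᵀ = δ • (Q * (X0 * Q)⁻¹ * Qᵀ) := by
    rw [hinv, transpose_smul]
    simp only [Matrix.smul_mul, Matrix.mul_smul, smul_smul]
    congr 1
    field_simp
  rw [e]
  exact hP.posSemidef
end
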